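/- arXiv:1210.5918 — 5 statements merged into one kernel-verified Lean document; each statement's English description precedes it below -/
import Mathlib

section
/- Let 0 < β < 1, let φ_s > 0, and let S > 0. If 0 ≤ T_a < T_b, then 1 − exp[(T_a/φ_s)^β − (T_a/φ_s + S)^β] > 1 − exp[(T_b/φ_s)^β − (T_b/φ_s + S)^β]; that is, in the Weibull CE model the conditional distribution function G(t | t>t₁; T_s) is strictly decreasing in the pre-test usage time T_s when the shape parameter satisfies 0 < β < 1. -/
/-- In the Weibull CE model with shape parameter `0 < β < 1`, the conditional
distribution function `G(t | t>t₁; T_s) = 1 − exp[(T_s/φ_s)^β − (T_s/φ_s + S)^β]`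
is strictly decreasing in the pre-test usage time `T_s`. -/
theorem stmt_0 (β φs S Ta Tb : ℝ) (hβ0 : 0 < β) (hβ1 : β < 1)
    (hφ : 0 < φs) (hS : 0 < S) (hTa : 0 ≤ Ta) (hab : Ta < Tb) :
    1 - Real.exp ((Ta / φs) ^ β - (Ta / φs + S) ^ β) >
      1 - Real.exp ((Tb / φs) ^ β - (Tb / φs + S) ^ β) := by
  have ha : 0 ≤ Ta / φs := by positivity
  have hlt : Ta / φs < Tb / φs := by gcongr
  generalize Ta / φs = a at *
  generalize Tb / φs = b at *
  have hd : 0 < b - a := by linarith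
  have hD : 0 < b - a + S := by linarith
  have hc := (Real.strictConcaveOn_rpow hβ0 hβ1).2
  have hsum : (b - a) / (b - a + S) + S / (b - a + S) = 1 := by field_simp
  have ma : a ∈ Set.Ici (0 : ℝ) := ha
  have mb : b + S ∈ Set.Ici (0 : ℝ) := by
    simp only [Set.mem_Ici]; linarith
  have hne : a ≠ b + S := by linarith
  have h1 := hc ma mb hne (div_pos hd hD) (div_pos hS hD) hsum
  have h2 := hc ma mb hne (div_pos hS hD) (div_pos hd hD) (by linarith)
  simp only [smul_eq_mul] at h1 h2
  have e1 : (b - a) / (b - a + S) * a + S / (b - a + S) * (b + S) = a + S := by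
    field_simp; ring
  have e2 : S / (b - a + S) * a + (b - a) / (b - a + S) * (b + S) = b := by
    field_simp; ring
  rw [e1] at h1
  rw [e2] at h2
  have e3 : S / (b - a + S) = 1 - (b - a) / (b - a + S) := by linarith
  rw [e3] at h1 h2
  have key : a ^ β - (a + S) ^ β < b ^ β - (b + S) ^ β := by linarith
  have := Real.exp_lt_exp.2 key
  linarith
end

section
/- Let 0 < β < 1, K > 0, n > 0, V_th ≥ 0, T_s > 0, and S > 0. If V_th < V_a < V_b, then with ε₁(V) = T_s·(V−V_th)^n/K, one has 1 − exp[ε₁(V_a)^β − (ε₁(V_a) + S)^β] > 1 − exp[ε₁(V_b)^β − (ε₁(V_b) + S)^β]; that is, the conditional distribution function G(t | t>t₁; V_s) is strictly decreasing in the normal stress V_s when 0 < β < 1. -/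
theorem rpow_incr_aux (β a b S : ℝ) (hβ0 : 0 < β) (hβ1 : β < 1) (ha : 0 < a) (hab : a < b)
    (hS : 0 < S) : a ^ β + (b + S) ^ β < b ^ β + (a + S) ^ β := by
  have hc := (Real.strictConcaveOn_rpow hβ0 hβ1).2
  have hD : 0 < b - a + S := by linarith
  have h1 : 0 < S / (b - a + S) := by positivity
  have h2 : 0 < (b - a) / (b - a + S) := div_pos (by linarith) hD
  have h3 : S / (b - a + S) + (b - a) / (b - a + S) = 1 := by
    field_simp; ring
  have hx : a ∈ Set.Ici (0:ℝ) := ha.le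
  have hy : b + S ∈ Set.Ici (0:ℝ) := by
    simp only [Set.mem_Ici]; linarith
  have hne : a ≠ b + S := by linarith
  have e1 := hc hx hy hne h1 h2 h3
  have e2 := hc hx hy hne h2 h1 (by linarith)
  simp only [smul_eq_mul] at e1 e2
  have q1 : S / (b - a + S) * a + (b - a) / (b - a + S) * (b + S) = b := by
    field_simp; ring
  have q2 : (b - a) / (b - a + S) * a + S / (b - a + S) * (b + S) = a + S := by
    field_simp; ring
  rw [q1] at e1
  rw [q2] at e2
  have h4 : (b - a) / (b - a + S) = 1 - S / (b - a + S) := by linarith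
  rw [h4] at e1 e2
  linarith

/-- In the Weibull CE model with the inverse power law `φ(V) = K/(V−V_th)^n`,
if `0 < β < 1` then the conditional distribution function
`G(t | t>t₁; V_s) = 1 − exp[ε₁(V_s)^β − (ε₁(V_s)+S)^β]`, with
`ε₁(V) = T_s·(V−V_th)^n/K`, is strictly decreasing in the normal stress `V_s`. -/
theorem stmt_4 (β K n Vth Ts S Va Vb : ℝ) (hβ0 : 0 < β) (hβ1 : β < 1)
    (hK : 0 < K) (hn : 0 < n) (hVth : 0 ≤ Vth) (hTs : 0 < Ts) (hS : 0 < S)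
    (hVa : Vth < Va) (hab : Va < Vb) :
    1 - Real.exp ((Ts * (Va - Vth) ^ n / K) ^ β -
        (Ts * (Va - Vth) ^ n / K + S) ^ β) >
      1 - Real.exp ((Ts * (Vb - Vth) ^ n / K) ^ β -
        (Ts * (Vb - Vth) ^ n / K + S) ^ β) := by
  have hp : 0 < Va - Vth := by linarith
  have ha : 0 < Ts * (Va - Vth) ^ n / K := by positivity
  have hlt : Ts * (Va - Vth) ^ n / K < Ts * (Vb - Vth) ^ n / K := by
    have := Real.rpow_lt_rpow hp.le (show Va - Vth < Vb - Vth by linarith) hn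
    gcongr
  have := rpow_incr_aux β _ _ S hβ0 hβ1 ha hlt hS
  apply sub_lt_sub_left
  apply Real.exp_lt_exp.mpr
  linarith
end

section
/- Let β > 1, K > 0, n > 0, V_th ≥ 0, T_s > 0, and S > 0. If V_th < V_a < V_b, then with ε₁(V) = T_s·(V−V_th)^n/K, one has 1 − exp[ε₁(V_a)^β − (ε₁(V_a) + S)^β] < 1 − exp[ε₁(V_b)^β − (ε₁(V_b) + S)^β]; that is, the conditional distribution function G(t | t>t₁; V_s) is strictly increasing in the normal stress V_s when β > 1. -/
/-- In the Weibull CE model with the inverse power law `φ(V) = K/(V−V_th)^n`,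
if `β > 1` then the conditional distribution function
`G(t | t>t₁; V_s) = 1 − exp[ε₁(V_s)^β − (ε₁(V_s)+S)^β]`, with
`ε₁(V) = T_s·(V−V_th)^n/K`, is strictly increasing in the normal stress `V_s`. -/
theorem stmt_6 (β K n Vth Ts S Va Vb : ℝ) (hβ : 1 < β)
    (hK : 0 < K) (hn : 0 < n) (hVth : 0 ≤ Vth) (hTs : 0 < Ts) (hS : 0 < S)
    (hVa : Vth < Va) (hab : Va < Vb) :
    1 - Real.exp ((Ts * (Va - Vth) ^ n / K) ^ β -
        (Ts * (Va - Vth) ^ n / K + S) ^ β) <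
      1 - Real.exp ((Ts * (Vb - Vth) ^ n / K) ^ β -
        (Ts * (Vb - Vth) ^ n / K + S) ^ β) := by
  have h0 : 0 < Va - Vth := by linarith
  have hp : (Va - Vth) ^ n < (Vb - Vth) ^ n :=
    Real.rpow_lt_rpow h0.le (by linarith) hn
  have ha : 0 < Ts * (Va - Vth) ^ n / K := by positivity
  have hlt : Ts * (Va - Vth) ^ n / K < Ts * (Vb - Vth) ^ n / K := by gcongr
  generalize Ts * (Va - Vth) ^ n / K = a at *
  generalize Ts * (Vb - Vth) ^ n / K = b at *
  have hc := strictConvexOn_rpow hβ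
  have hma : a ∈ Set.Ici (0 : ℝ) := ha.le
  have hmb : b + S ∈ Set.Ici (0 : ℝ) := by
    simp only [Set.mem_Ici]; linarith
  have h1 := hc.secant_strict_mono_aux1 (y := a + S) hma hmb (by linarith) (by linarith)
  have h2 := hc.secant_strict_mono_aux1 (y := b) hma hmb hlt (by linarith)
  have h3 : (b + S - a) * ((a + S) ^ β + b ^ β) < (b + S - a) * (a ^ β + (b + S) ^ β) := by
    linarith
  have h4 := lt_of_mul_lt_mul_left h3 (by linarith)
  apply sub_lt_sub_left
  apply Real.exp_lt_exp.mpr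
  linarith
end

section
/- Let β > 0, φ > 0, x₀ < x₁, and let e₁ > 0 and e₀ ≥ e₁. Define ε(x) = e₀ + (x − x₀)/φ for x ∈ [x₀, x₁], and define A(x) = exp[e₁^β − ε(x)^β]·∫₀^∞ (u + ε(x)^β)^{1/β − 1} e^{−u} du. Then ∫_{x₀}^{x₁} exp[e₁^β − ε(x)^β] dx = (φ/β)·(A(x₀) − A(x₁)). -/
open MeasureTheory Set in
lemma aux_tail (β e : ℝ) (hβ : 0 < β) (he : 0 < e) :
    ∫ u in Set.Ioi (0 : ℝ), (u + e ^ β) ^ (1 / β - 1) * Real.exp (-u) =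
      Real.exp (e ^ β) * (β * ∫ x in Set.Ioi e, Real.exp (-x ^ β)) := by
  have h1 := integral_comp_rpow_Ioi_of_pos' (g := fun y : ℝ => y ^ (1 / β - 1) * Real.exp (-y))
    hβ (c := e ^ β) (by positivity)
  have h2 : (e ^ β) ^ β⁻¹ = e := Real.rpow_rpow_inv he.le hβ.ne'
  rw [h2] at h1
  have h3 : ∫ x in Ioi e, (β * x ^ (β - 1)) • ((x ^ β) ^ (1 / β - 1) * Real.exp (-x ^ β))
      = β * ∫ x in Set.Ioi e, Real.exp (-x ^ β) := by
    rw [← integral_const_mul]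
    refine setIntegral_congr_fun measurableSet_Ioi fun x hx => ?_
    have hx0 : 0 < x := he.trans hx
    have : x ^ (β - 1) * (x ^ β) ^ (1 / β - 1) = 1 := by
      rw [← Real.rpow_mul hx0.le, ← Real.rpow_add hx0]
      have : β - 1 + β * (1 / β - 1) = 0 := by field_simp; ring
      rw [this, Real.rpow_zero]
    simp only [smul_eq_mul]
    linear_combination (β * Real.exp (-x ^ β)) * this
  rw [h3] at h1
  rw [h1, ← integral_const_mul]
  have h4 := (measurePreserving_add_right volume (e ^ β)).setIntegral_preimage_emb
    (measurableEmbedding_addRight (e ^ β))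
    (fun y : ℝ => Real.exp (e ^ β) * (y ^ (1 / β - 1) * Real.exp (-y))) (Ioi (e ^ β))
  rw [← h4]
  have h5 : (fun x => x + e ^ β) ⁻¹' Ioi (e ^ β) = Ioi 0 := by
    ext; simp
  rw [h5]
  refine setIntegral_congr_fun measurableSet_Ioi fun x hx => ?_
  have : Real.exp (-x) = Real.exp (e ^ β) * Real.exp (-(x + e ^ β)) := by
    rw [← Real.exp_add]; congr 1; ring
  simp only [this]
  ring


/-- Stagewise integral of the conditional survival function in the Weibull CE
model: with affine exposure `ε(x) = e₀ + (x − x₀)/φ` on a stage `[x₀, x₁]` and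
`A(x) = exp[e₁^β − ε(x)^β]·∫₀^∞ (u + ε(x)^β)^{1/β−1} e^{−u} du`, one has
`∫_{x₀}^{x₁} exp[e₁^β − ε(x)^β] dx = (φ/β)·(A(x₀) − A(x₁))`. -/
theorem stmt_12 (β φ x₀ x₁ e₁ e₀ : ℝ) (hβ : 0 < β) (hφ : 0 < φ)
    (hx : x₀ < x₁) (he₁ : 0 < e₁) (he₀ : e₁ ≤ e₀)
    (ε : ℝ → ℝ) (hε : ε = fun x => e₀ + (x - x₀) / φ)
    (A : ℝ → ℝ) (hA : A = fun x => Real.exp (e₁ ^ β - (ε x) ^ β) *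
      ∫ u in Set.Ioi (0 : ℝ),
        (u + (ε x) ^ β) ^ (1 / β - 1) * Real.exp (-u)) :
    ∫ x in x₀..x₁, Real.exp (e₁ ^ β - (ε x) ^ β) =
      (φ / β) * (A x₀ - A x₁) := by

  subst hε hA
  have hd : 0 < (x₁ - x₀) / φ := div_pos (by linarith) hφ
  have h0 : 0 < e₀ := he₁.trans_le he₀
  have hint : ∀ a : ℝ, 0 < a →
      MeasureTheory.IntegrableOn (fun x : ℝ => Real.exp (-x ^ β)) (Set.Ioi a) := by
    intro a ha
    have := integrableOn_rpow_mul_exp_neg_rpow (s := 0) (p := β) (by norm_num) hβ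
    simp only [Real.rpow_zero, one_mul] at this
    exact this.mono_set (Set.Ioi_subset_Ioi ha.le)
  simp only [sub_self, zero_div, add_zero]
  have hs := intervalIntegral.integral_Ioi_sub_Ioi (hint e₀ h0) (b := e₀ + (x₁ - x₀) / φ) (by linarith)
  rw [aux_tail β e₀ hβ h0, aux_tail β _ hβ (by linarith : 0 < e₀ + (x₁ - x₀) / φ)]
  have key : ∀ a I : ℝ, Real.exp (e₁ ^ β - a) * (Real.exp a * (β * I))
      = Real.exp (e₁ ^ β) * (β * I) := by
    intro a I
    rw [← mul_assoc, ← Real.exp_add, sub_add_cancel]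
  rw [key, key, ← mul_sub, ← mul_sub, hs]
  have hc := intervalIntegral.integral_comp_div_add
    (fun y : ℝ => Real.exp (e₁ ^ β - y ^ β)) hφ.ne' (e₀ - x₀ / φ) (a := x₀) (b := x₁)
  have e1 : ∀ x, x / φ + (e₀ - x₀ / φ) = e₀ + (x - x₀) / φ := by intro x; ring
  simp only [e1, sub_self, zero_div, add_zero, smul_eq_mul] at hc
  rw [hc]
  have : ∀ y : ℝ, Real.exp (e₁ ^ β - y ^ β) = Real.exp (e₁ ^ β) * Real.exp (-y ^ β) := by
    intro y; rw [← Real.exp_add, sub_eq_add_neg]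
  simp only [this, intervalIntegral.integral_const_mul]
  field_simp
end

section
/- Let β > 0, φ > 0, t₁ ≤ x₀ < x₁, and let e₁ > 0 and e₀ ≥ e₁. Define ε(x) = e₀ + (x − x₀)/φ for x ∈ [x₀, x₁], and define B(x) = exp[e₁^β − ε(x)^β]·∫₀^∞ {(u + ε(x)^β)^{1/β} − (e₀ − (x₀ − t₁)/φ)}·(u + ε(x)^β)^{1/β − 1} e^{−u} du. Then ∫_{x₀}^{x₁} (x − t₁)·exp[e₁^β − ε(x)^β] dx = (φ²/β)·(B(x₀) − B(x₁)). -/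
/-- Stagewise integral arising in the second moment of failure time in the
Weibull CE model: with affine exposure `ε(x) = e₀ + (x − x₀)/φ` on a stage
`[x₀, x₁]` and
`B(x) = exp[e₁^β − ε(x)^β]·∫₀^∞ {(u + ε(x)^β)^{1/β} − (e₀ − (x₀ − t₁)/φ)}·(u + ε(x)^β)^{1/β−1} e^{−u} du`,
one has `∫_{x₀}^{x₁} (x − t₁)·exp[e₁^β − ε(x)^β] dx = (φ²/β)·(B(x₀) − B(x₁))`. -/
theorem stmt_15 (β φ t₁ x₀ x₁ e₁ e₀ : ℝ) (hβ : 0 < β) (hφ : 0 < φ)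
    (ht : t₁ ≤ x₀) (hx : x₀ < x₁) (he₁ : 0 < e₁) (he₀ : e₁ ≤ e₀)
    (ε : ℝ → ℝ) (hε : ε = fun x => e₀ + (x - x₀) / φ)
    (B : ℝ → ℝ) (hB : B = fun x => Real.exp (e₁ ^ β - (ε x) ^ β) *
      ∫ u in Set.Ioi (0 : ℝ),
        ((u + (ε x) ^ β) ^ (1 / β) - (e₀ - (x₀ - t₁) / φ)) *
          (u + (ε x) ^ β) ^ (1 / β - 1) * Real.exp (-u)) :
    ∫ x in x₀..x₁, (x - t₁) * Real.exp (e₁ ^ β - (ε x) ^ β) =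
      (φ ^ 2 / β) * (B x₀ - B x₁) := by
  set c : ℝ := e₀ - (x₀ - t₁) / φ with hc
  have hφ0 : φ ≠ 0 := hφ.ne'
  have he₀p : 0 < e₀ := lt_of_lt_of_le he₁ he₀
  let G : ℝ → ℝ := fun v => (v ^ (1 / β) - c) * v ^ (1 / β - 1) * Real.exp (-v)
  have hεpos : ∀ x, x₀ ≤ x → 0 < ε x := by
    intro x hx'
    have : 0 ≤ (x - x₀) / φ := div_nonneg (by linarith) hφ.le
    rw [hε]
    show 0 < e₀ + (x - x₀) / φ
    linarith
  have hGint : MeasureTheory.IntegrableOn G (Set.Ioi 0) := by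
    have h1 := Real.GammaIntegral_convergent (s := 2 / β) (by positivity)
    have h2 := (Real.GammaIntegral_convergent (s := 1 / β) (by positivity)).const_mul c
    refine (h1.sub h2).congr_fun ?_ measurableSet_Ioi
    intro v hv
    have hv : 0 < v := hv
    have : v ^ (2 / β - 1) = v ^ (1 / β) * v ^ (1 / β - 1) := by
      rw [← Real.rpow_add hv]; congr 1; ring
    simp only [G, Pi.sub_apply, this]
    ring
  have hBG : ∀ x, x₀ ≤ x → B x = Real.exp (e₁ ^ β) * ∫ v in Set.Ioi (ε x ^ β), G v := by
    intro x hx'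
    have htr := (MeasureTheory.measurePreserving_add_right MeasureTheory.volume
      (ε x ^ β)).setIntegral_preimage_emb (measurableEmbedding_addRight (ε x ^ β)) G
      (Set.Ioi (ε x ^ β))
    have hpre : (fun u : ℝ => u + ε x ^ β) ⁻¹' Set.Ioi (ε x ^ β) = Set.Ioi 0 := by
      ext u; simp
    rw [hpre] at htr
    rw [← htr, hB]
    simp only [G]
    rw [← MeasureTheory.integral_const_mul, ← MeasureTheory.integral_const_mul]
    congr 1
    ext u
    rw [neg_add, Real.exp_add, sub_eq_add_neg (e₁ ^ β), Real.exp_add]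
    ring
  have hderε : ∀ x, HasDerivAt ε (1 / φ) x := by
    intro x
    rw [hε]
    exact (((hasDerivAt_id x).sub_const x₀).div_const φ).const_add e₀
  have hder : ∀ x, x₀ ≤ x →
      HasDerivAt (fun y => ε y ^ β) (1 / φ * β * ε x ^ (β - 1)) x := by
    intro x hx'
    exact (hderε x).rpow_const (Or.inl (hεpos x hx').ne')
  have hsub := intervalIntegral.integral_comp_mul_deriv_of_deriv_nonneg
    (a := x₀) (b := x₁) (f := fun y => ε y ^ β)
    (f' := fun x => 1 / φ * β * ε x ^ (β - 1)) (g := G)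
    (by
      rw [Set.uIcc_of_le hx.le]
      exact fun x h => (hder x h.1).continuousAt.continuousWithinAt)
    (by
      rw [min_eq_left hx.le]
      exact fun x h => hder x h.1.le)
    (by
      rw [min_eq_left hx.le]
      intro x h
      have := hεpos x h.1.le
      positivity)
  have hp0 : 0 < ε x₀ ^ β := Real.rpow_pos_of_pos (hεpos x₀ le_rfl) _
  have hp1 : 0 < ε x₁ ^ β := Real.rpow_pos_of_pos (hεpos x₁ hx.le) _
  rw [hBG x₀ le_rfl, hBG x₁ hx.le, ← mul_sub,
    intervalIntegral.integral_Ioi_sub_Ioi' (hGint.mono_set (Set.Ioi_subset_Ioi hp0.le))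
      (hGint.mono_set (Set.Ioi_subset_Ioi hp1.le)), ← hsub,
    ← intervalIntegral.integral_const_mul, ← intervalIntegral.integral_const_mul]
  apply intervalIntegral.integral_congr
  intro x hxm
  rw [Set.uIcc_of_le hx.le] at hxm
  have hp := hεpos x hxm.1
  have r1 : (ε x ^ β) ^ (1 / β) = ε x := by
    rw [← Real.rpow_mul hp.le, mul_one_div_cancel hβ.ne', Real.rpow_one]
  have r2 : (ε x ^ β) ^ (1 / β - 1) * ε x ^ (β - 1) = 1 := by
    rw [← Real.rpow_mul hp.le, ← Real.rpow_add hp]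
    have : β * (1 / β - 1) + (β - 1) = 0 := by field_simp; ring
    rw [this, Real.rpow_zero]
  have r3 : ε x - c = (x - t₁) / φ := by
    rw [hc, hε]; field_simp; ring
  simp only [G, Function.comp]
  rw [r1, r3, sub_eq_add_neg (e₁ ^ β), Real.exp_add]
  calc (x - t₁) * (Real.exp (e₁ ^ β) * Real.exp (-ε x ^ β))
      = (x - t₁) * (Real.exp (e₁ ^ β) * Real.exp (-ε x ^ β)) *
        ((ε x ^ β) ^ (1 / β - 1) * ε x ^ (β - 1)) := by rw [r2, mul_one]
    _ = _ := by
      generalize (ε x ^ β) ^ (1 / β - 1) = p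
      generalize ε x ^ (β - 1) = q
      field_simp
end
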